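/- arXiv:1609.02471 — 2 statements merged into one kernel-verified Lean document; each statement's English description precedes it below -/
import Mathlib

section
/- Let μ : ℤ² → ℝ be summable with μ(j) ≥ 0 for all j ≠ 0, with total mass ∑_{j∈ℤ²} μ(j) = 0, radial in the sense that μ(j) = μ(j′) whenever |j| = |j′|, and with μ((0,1)) > 0. Then there exists a constant c_f > 0 such that for all x ∈ [−π,π]² one has ∑_{j∈ℤ²} (1 − cos⟨x,j⟩) μ(j) ≥ c_f |x|², where ⟨·,·⟩ is the Euclidean inner product on ℝ². -/
open Real

/-- Lower bound on the symbol of the discrete Laplacian.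
If `μ : ℤ² → ℝ` is summable, nonnegative outside the origin, has total mass zero,
is radial, and charges `(0,1)`, then there is `c > 0` such that
`∑_j (1 - cos⟨x,j⟩) μ(j) ≥ c‖x‖²` for all `x ∈ [-π,π]²`. -/
theorem discrete_symbol_lower_bound
    (μ : ℤ × ℤ → ℝ) (hsum : Summable μ)
    (hpos : ∀ j : ℤ × ℤ, j ≠ 0 → 0 ≤ μ j)
    (hmass : ∑' j : ℤ × ℤ, μ j = 0)
    (hradial : ∀ j j' : ℤ × ℤ, j.1 ^ 2 + j.2 ^ 2 = j'.1 ^ 2 + j'.2 ^ 2 → μ j = μ j')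
    (h01 : 0 < μ (0, 1)) :
    ∃ c : ℝ, 0 < c ∧ ∀ x : ℝ × ℝ, x.1 ∈ Set.Icc (-π) π → x.2 ∈ Set.Icc (-π) π →
      c * (x.1 ^ 2 + x.2 ^ 2) ≤
        ∑' j : ℤ × ℤ, (1 - Real.cos (x.1 * (j.1 : ℝ) + x.2 * (j.2 : ℝ))) * μ j := by
  have h10 : μ (1, 0) = μ (0, 1) := hradial _ _ (by norm_num)
  refine ⟨2 / π ^ 2 * μ (0, 1), by positivity, ?_⟩
  intro x hx1 hx2
  have b1 : cos x.1 ≤ 1 - 2 / π ^ 2 * x.1 ^ 2 := cos_le_one_sub_mul_cos_sq (abs_le.2 hx1)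
  have b2 : cos x.2 ≤ 1 - 2 / π ^ 2 * x.2 ^ 2 := cos_le_one_sub_mul_cos_sq (abs_le.2 hx2)
  set f : ℤ × ℤ → ℝ := fun j =>
    (1 - Real.cos (x.1 * (j.1 : ℝ) + x.2 * (j.2 : ℝ))) * μ j with hf
  have hnn : ∀ j, 0 ≤ f j := by
    intro j
    by_cases hj : j = 0
    · subst hj
      simp [hf]
    · exact mul_nonneg (sub_nonneg.2 (Real.cos_le_one _)) (hpos j hj)
  have hs : Summable f := by
    refine Summable.of_norm_bounded (g := fun j => 2 * ‖μ j‖) (hsum.norm.mul_left 2) ?_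
    intro j
    rw [hf, norm_mul]
    refine mul_le_mul_of_nonneg_right ?_ (norm_nonneg _)
    rw [Real.norm_eq_abs, abs_le]
    constructor
    · linarith [Real.cos_le_one (x.1 * (j.1 : ℝ) + x.2 * (j.2 : ℝ))]
    · linarith [Real.neg_one_le_cos (x.1 * (j.1 : ℝ) + x.2 * (j.2 : ℝ))]
  have key := hs.sum_le_tsum {((1 : ℤ), (0 : ℤ)), ((0 : ℤ), (1 : ℤ))} (fun j _ => hnn j)
  rw [Finset.sum_pair (by decide)] at key
  refine le_trans ?_ key
  simp only [hf, h10]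
  norm_num
  nlinarith [mul_le_mul_of_nonneg_right b1 h01.le, mul_le_mul_of_nonneg_right b2 h01.le]
end

section
/- For all constants 0 < a ≤ b there exists a constant C such that for every integer q ≥ 0: ∑_{k₁,k₂ ∈ ℤ², k₁ ≠ 0} 1_{a·2^q ≤ |k₁+k₂| ≤ b·2^q} · 1_{a|k₁| ≤ |k₂| ≤ b|k₁|} · |k₁|^{−4} ≤ C. -/
open Real

/-- The Euclidean norm of a lattice point `k ∈ ℤ²`. -/
noncomputable def znorm (k : ℤ × ℤ) : ℝ := Real.sqrt ((k.1 : ℝ) ^ 2 + (k.2 : ℝ) ^ 2)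

lemma aux_range (m : ℝ) (hm : 1 ≤ m) (N : ℕ) :
    ∑ n ∈ Finset.range N, ((n : ℝ) ^ 2 + m ^ 2)⁻¹ ≤ 4 / m - 4 / (m + N) := by
  induction N with
  | zero => simp
  | succ N ih =>
    rw [Finset.sum_range_succ]
    have hN : (0 : ℝ) ≤ N := Nat.cast_nonneg N
    have key : ((N : ℝ) ^ 2 + m ^ 2)⁻¹ ≤ 4 / (m + N) - 4 / (m + (N + 1)) := by
      have h1 : 0 < m + N := by linarith
      have h2 : 4 / (m + N) - 4 / (m + (N + 1)) = 4 / ((m + N) * (m + (N + 1))) := by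
        have h3 : m + ((N : ℝ) + 1) ≠ 0 := by positivity
        field_simp
        ring
      rw [h2, inv_eq_one_div, div_le_div_iff₀ (by positivity) (by positivity)]
      nlinarith [sq_nonneg (m - N), mul_nonneg hN hN]
    push_cast
    linarith

lemma aux_int (m : ℝ) (hm : 1 ≤ m) (T : Finset ℤ) :
    ∑ x ∈ T, ((x : ℝ) ^ 2 + m ^ 2)⁻¹ ≤ 8 / m := by
  classical
  set N : ℕ := T.sup Int.natAbs + 1 with hN
  have hb : ∑ n ∈ Finset.range N, ((n : ℝ) ^ 2 + m ^ 2)⁻¹ ≤ 4 / m := by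
    have := aux_range m hm N
    have h2 : 0 ≤ 4 / (m + N) := by positivity
    linarith
  have hsub : T ⊆ (Finset.range N).image (fun n : ℕ => (n : ℤ)) ∪
      (Finset.range N).image (fun n : ℕ => -(n : ℤ)) := by
    intro x hx
    have : x.natAbs ≤ T.sup Int.natAbs := Finset.le_sup (f := Int.natAbs) hx
    simp only [Finset.mem_union, Finset.mem_image, Finset.mem_range]
    rcases Int.natAbs_eq x with h | h
    · exact Or.inl ⟨x.natAbs, by omega, h.symm⟩
    · exact Or.inr ⟨x.natAbs, by omega, h.symm⟩
  have hpos : ∀ x : ℤ, 0 ≤ ((x : ℝ) ^ 2 + m ^ 2)⁻¹ := fun x => by positivity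
  calc _ ≤ ∑ x ∈ (Finset.range N).image (fun n : ℕ => (n : ℤ)) ∪
      (Finset.range N).image (fun n : ℕ => -(n : ℤ)), ((x : ℝ) ^ 2 + m ^ 2)⁻¹ :=
        Finset.sum_le_sum_of_subset_of_nonneg hsub (fun x _ _ => hpos x)
    _ ≤ ∑ x ∈ (Finset.range N).image (fun n : ℕ => (n : ℤ)), ((x : ℝ) ^ 2 + m ^ 2)⁻¹ +
        ∑ x ∈ (Finset.range N).image (fun n : ℕ => -(n : ℤ)), ((x : ℝ) ^ 2 + m ^ 2)⁻¹ := by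
        rw [← Finset.sum_union_inter]
        exact le_add_of_nonneg_right (Finset.sum_nonneg fun x _ => hpos x)
    _ = ∑ n ∈ Finset.range N, ((n : ℝ) ^ 2 + m ^ 2)⁻¹ +
        ∑ n ∈ Finset.range N, ((n : ℝ) ^ 2 + m ^ 2)⁻¹ := by
        rw [Finset.sum_image (by intro x _ y _ h; simpa using h),
          Finset.sum_image (by intro x _ y _ h; simpa using h)]
        simp
    _ ≤ 8 / m := by
        have : 8 / m = 4 / m + 4 / m := by ring
        linarith

lemma aux_four (f : ℤ → ℝ) (hf : ∀ x, 0 ≤ f x) (B : ℝ)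
    (hB : ∀ T : Finset ℤ, ∑ x ∈ T, f x ≤ B) (S : Finset ((ℤ × ℤ) × (ℤ × ℤ))) :
    ∑ k ∈ S, (f k.1.1 * f k.1.2) * (f (k.1.1 + k.2.1) * f (k.1.2 + k.2.2)) ≤ B ^ 4 := by
  classical
  have hB0 : 0 ≤ B := by simpa using hB ∅
  have h2 : ∀ T : Finset (ℤ × ℤ), ∑ p ∈ T, f p.1 * f p.2 ≤ B ^ 2 := by
    intro T
    calc _ ≤ ∑ p ∈ T.image Prod.fst ×ˢ T.image Prod.snd, f p.1 * f p.2 :=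
          Finset.sum_le_sum_of_subset_of_nonneg Finset.subset_product
            (fun p _ _ => mul_nonneg (hf _) (hf _))
      _ = (∑ x ∈ T.image Prod.fst, f x) * ∑ y ∈ T.image Prod.snd, f y := by
          rw [Finset.sum_mul_sum, Finset.sum_product]
      _ ≤ B * B := mul_le_mul (hB _) (hB _) (Finset.sum_nonneg fun _ _ => hf _) hB0
      _ = B ^ 2 := by ring
  let g : ℤ × ℤ → ℝ := fun p => f p.1 * f p.2
  have hg : ∀ p, 0 ≤ g p := fun p => mul_nonneg (hf _) (hf _)
  let e : (ℤ × ℤ) × (ℤ × ℤ) → (ℤ × ℤ) × (ℤ × ℤ) := fun k => (k.1, k.1 + k.2)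
  have he : Function.Injective e := by
    rintro ⟨k, l⟩ ⟨k', l'⟩ h
    simp only [e, Prod.mk.injEq] at h
    obtain ⟨h1, h3⟩ := h
    subst h1
    simpa using h3
  calc _ = ∑ p ∈ S.image e, g p.1 * g p.2 := by
        rw [Finset.sum_image he.injOn]
        rfl
    _ ≤ ∑ p ∈ (S.image e).image Prod.fst ×ˢ (S.image e).image Prod.snd, g p.1 * g p.2 :=
          Finset.sum_le_sum_of_subset_of_nonneg Finset.subset_product
            (fun p _ _ => mul_nonneg (hg _) (hg _))
    _ = (∑ x ∈ (S.image e).image Prod.fst, g x) * ∑ y ∈ (S.image e).image Prod.snd, g y := by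
          rw [Finset.sum_mul_sum, Finset.sum_product]
    _ ≤ B ^ 2 * B ^ 2 := mul_le_mul (h2 _) (h2 _) (Finset.sum_nonneg fun _ _ => hg _)
          (by positivity)
    _ = B ^ 4 := by ring

lemma aux_pt (a b m x y z w : ℝ) (ha : 0 < a) (hm : 1 ≤ m)
    (h1 : (a * m) ^ 2 ≤ (x + z) ^ 2 + (y + w) ^ 2)
    (h2 : (x + z) ^ 2 + (y + w) ^ 2 ≤ (b * m) ^ 2)
    (h3 : z ^ 2 + w ^ 2 ≤ b ^ 2 * (x ^ 2 + y ^ 2)) :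
    ((x ^ 2 + y ^ 2) ^ 2)⁻¹ ≤ ((1 + 2 * (1 + b ^ 2) / a ^ 2) ^ 2 * (b ^ 2 + 1) ^ 2 * m ^ 4) *
      (((x ^ 2 + m ^ 2)⁻¹ * (y ^ 2 + m ^ 2)⁻¹) *
        (((x + z) ^ 2 + m ^ 2)⁻¹ * ((y + w) ^ 2 + m ^ 2)⁻¹)) := by
  have hn : m ^ 2 ≤ 2 * (1 + b ^ 2) / a ^ 2 * (x ^ 2 + y ^ 2) := by
    rw [div_mul_eq_mul_div, le_div_iff₀ (by positivity)]
    nlinarith [sq_nonneg (x - z), sq_nonneg (y - w)]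
  have hn0 : 0 < x ^ 2 + y ^ 2 := by
    by_contra h
    have h0 : x ^ 2 + y ^ 2 = 0 := le_antisymm (not_lt.mp h) (by positivity)
    rw [h0, mul_zero] at hn
    nlinarith
  set E := 2 * (1 + b ^ 2) / a ^ 2 with hE
  set n := x ^ 2 + y ^ 2 with hnn
  have hx : x ^ 2 + m ^ 2 ≤ (1 + E) * n := by nlinarith [sq_nonneg y]
  have hy : y ^ 2 + m ^ 2 ≤ (1 + E) * n := by nlinarith [sq_nonneg x]
  have hu : (x + z) ^ 2 + m ^ 2 ≤ (b ^ 2 + 1) * m ^ 2 := by nlinarith [sq_nonneg (y + w)]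
  have hv : (y + w) ^ 2 + m ^ 2 ≤ (b ^ 2 + 1) * m ^ 2 := by nlinarith [sq_nonneg (x + z)]
  have hE0 : 0 ≤ E := by positivity
  have hP : (x ^ 2 + m ^ 2) * (y ^ 2 + m ^ 2) * (((x + z) ^ 2 + m ^ 2) * ((y + w) ^ 2 + m ^ 2)) ≤
      ((1 + E) * n) * ((1 + E) * n) * (((b ^ 2 + 1) * m ^ 2) * ((b ^ 2 + 1) * m ^ 2)) := by
    gcongr
  rw [← mul_inv, ← mul_inv, ← mul_inv, ← div_eq_mul_inv, inv_eq_one_div,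
    div_le_div_iff₀ (by positivity) (by positivity)]
  linarith

/-- Deterministic counting estimate for the resonant product. For
`0 < a ≤ b` there is a constant `C` such that, uniformly over dyadic levels `q`,
`∑_{k₁ ≠ 0} 1_{a 2^q ≤ |k₁+k₂| ≤ b 2^q} 1_{a|k₁| ≤ |k₂| ≤ b|k₁|} |k₁|⁻⁴ ≤ C`
(stated via uniform bounds over all finite partial sums). -/
theorem resonant_counting_estimate (a b : ℝ) (ha : 0 < a) (hab : a ≤ b) :
    ∃ C : ℝ, ∀ q : ℕ, ∀ S : Finset ((ℤ × ℤ) × (ℤ × ℤ)),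
      ∑ k ∈ S,
        (if k.1 ≠ 0 ∧
            a * 2 ^ q ≤ znorm (k.1 + k.2) ∧ znorm (k.1 + k.2) ≤ b * 2 ^ q ∧
            a * znorm k.1 ≤ znorm k.2 ∧ znorm k.2 ≤ b * znorm k.1 then
          ((((k.1.1 : ℝ) ^ 2 + (k.1.2 : ℝ) ^ 2) ^ 2)⁻¹ : ℝ)
        else 0) ≤ C := by
  refine ⟨(1 + 2 * (1 + b ^ 2) / a ^ 2) ^ 2 * (b ^ 2 + 1) ^ 2 * 8 ^ 4, fun q S => ?_⟩
  set m : ℝ := 2 ^ q with hmdef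
  have hm : 1 ≤ m := one_le_pow₀ (by norm_num)
  have hsq : ∀ k : ℤ × ℤ, znorm k ^ 2 = (k.1 : ℝ) ^ 2 + (k.2 : ℝ) ^ 2 := fun k =>
    Real.sq_sqrt (by positivity)
  have hz : ∀ k : ℤ × ℤ, 0 ≤ znorm k := fun k => Real.sqrt_nonneg _
  let f : ℤ → ℝ := fun x => ((x : ℝ) ^ 2 + m ^ 2)⁻¹
  have hf : ∀ x, 0 ≤ f x := fun x => by positivity
  set K := (1 + 2 * (1 + b ^ 2) / a ^ 2) ^ 2 * (b ^ 2 + 1) ^ 2 with hK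
  calc _ ≤ ∑ k ∈ S, (K * m ^ 4) *
        ((f k.1.1 * f k.1.2) * (f (k.1.1 + k.2.1) * f (k.1.2 + k.2.2))) := by
        apply Finset.sum_le_sum
        rintro ⟨⟨x, y⟩, ⟨z, w⟩⟩ _
        split_ifs with h
        · obtain ⟨-, h1, h2, -, h3⟩ := h
          have h1' := pow_le_pow_left₀ (by positivity) h1 2
          have h2' := pow_le_pow_left₀ (hz _) h2 2
          have h3' := pow_le_pow_left₀ (hz _) h3 2
          rw [mul_pow b, hsq, hsq] at h3'
          rw [hsq] at h1' h2'
          simp only [Prod.fst_add, Prod.snd_add, Int.cast_add] at h1' h2' h3'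
          have := aux_pt a b m x y z w ha hm h1' h2' h3'
          simpa only [f, Int.cast_add] using this
        · have := hf x; have := hf y; have := hf (x + z); have := hf (y + w)
          positivity
    _ ≤ (K * m ^ 4) * (8 / m) ^ 4 := by
        rw [← Finset.mul_sum]
        exact mul_le_mul_of_nonneg_left (aux_four f hf _ (aux_int m hm) S) (by positivity)
    _ = K * 8 ^ 4 := by
        have : m ≠ 0 := by positivity
        field_simp
end
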